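/- Let n ≥ 2 and let △ₙ ⊂ ℝⁿ be the convex hull of the stack-sorting iterates of τₙ = 2 3 ⋯ (n−1) n 1. Then △ₙ is Gorenstein of index 2: the relative interior of △ₙ contains no integer point, the relative interior of 2△ₙ contains exactly one integer point, and for every nonnegative integer t the number of integer points in the relative interior of (t+2)△ₙ equals the number of integer points in t△ₙ, i.e., L_ℤ(△ₙ°; t+2) = L_ℤ(△ₙ; t) = (t+1)^{n−1}. -/

import Mathlib

open scoped Pointwise

/-- One pass of the stack-sorting algorithm: `ssAux stack input`, where
`stack` holds the current stack contents, top first.  If the next input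
entry exceeds the top of the stack, the top is popped to the output;
otherwise the entry is pushed; at the end the stack is popped entirely. -/
def ssAux : List ℕ → List ℕ → List ℕ
  | stack, [] => stack
  | [], x :: xs => ssAux [x] xs
  | t :: ts, x :: xs =>
    if t < x then t :: ssAux ts (x :: xs) else ssAux (x :: t :: ts) xs
termination_by stack inp => stack.length + 2 * inp.length

/-- The stack-sorting map `s`: one pass of the stack-sorting algorithm. -/
def stackSort (l : List ℕ) : List ℕ := ssAux [] l

/-- A list of naturals, viewed as a point of `ℝⁿ` (entry `i` is the `i`-th
element of the list). -/
def toPoint (n : ℕ) (l : List ℕ) : Fin n → ℝ := fun i => (l.getD i 0 : ℝ)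

/-- The permutation `τₙ = 2 3 ⋯ (n-1) n 1`, as a list. -/
def tauList (n : ℕ) : List ℕ := List.range' 2 (n - 1) ++ [1]

/-- The point of `ℝⁿ` corresponding to `τₙ = 2 3 ⋯ (n-1) n 1`. -/
noncomputable def tauPt (n : ℕ) : Fin n → ℝ := toPoint n (tauList n)

/-- The set `𝒮^{τₙ} = {s⁰(τₙ), s¹(τₙ), …, s^{n-1}(τₙ)} ⊆ ℝⁿ` of
stack-sorting iterates of `τₙ`, regarded as points of `ℝⁿ`. -/
noncomputable def ssIterates (n : ℕ) : Set (Fin n → ℝ) :=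
  Set.range fun i : Fin n => toPoint n (stackSort^[(i : ℕ)] (tauList n))

/-- The simplex `△ₙ`: the convex hull of the stack-sorting iterates of
`τₙ = 2 3 ⋯ (n-1) n 1`. -/
noncomputable def ssSimplex (n : ℕ) : Set (Fin n → ℝ) :=
  convexHull ℝ (ssIterates n)

/-- `x ∈ ℝⁿ` is a lattice (integer) point if all its coordinates are integers. -/
def IsLatticePt {n : ℕ} (x : Fin n → ℝ) : Prop := ∀ i, ∃ z : ℤ, x i = (z : ℝ)

/-- The number of lattice points of a subset of `ℝⁿ`. -/
noncomputable def lattCount {n : ℕ} (S : Set (Fin n → ℝ)) : ℕ :=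
  Set.ncard {x ∈ S | IsLatticePt x}

theorem ssAux_range'_append (a m : ℕ) (l : List ℕ) :
    ssAux [a] (List.range' (a + 1) m ++ l) = List.range' a m ++ ssAux [a + m] l := by
  induction m generalizing a with
  | zero => simp
  | succ m ih =>
    rw [List.range'_succ, List.range'_succ, List.cons_append, ssAux, if_pos (Nat.lt_succ_self a),
      ssAux, ih, List.cons_append, Nat.add_right_comm, Nat.add_assoc]

theorem ssAux_one_range' (a i : ℕ) (ha : 1 ≤ a) :
    ssAux [1, a] (List.range' (a + 1) i) = 1 :: List.range' a (i + 1) := by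
  have key : ssAux [a] (List.range' (a + 1) i) = List.range' a (i + 1) := by
    have h := ssAux_range'_append a i []
    rw [List.append_nil] at h
    rw [h, List.range'_concat, ssAux, Nat.one_mul]
  cases i with
  | zero => simp [ssAux]
  | succ i =>
    rw [← key, List.range'_succ, ssAux, if_pos (by omega)]

theorem stackSort_step (m i : ℕ) :
    stackSort (List.range' 2 (m + 1) ++ 1 :: List.range' (m + 3) i) =
      List.range' 2 m ++ 1 :: List.range' (m + 2) (i + 1) := by
  rw [stackSort, List.range'_succ, List.cons_append, ssAux, ssAux_range'_append, ssAux,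
    if_neg (by omega), show m + 3 = 2 + m + 1 by omega, ssAux_one_range' _ _ (by omega),
    Nat.add_comm 2 m]

theorem stackSort_iterate_tauList (m i : ℕ) :
    stackSort^[i] (tauList (m + i + 1)) = List.range' 2 m ++ 1 :: List.range' (m + 2) i := by
  induction i generalizing m with
  | zero => simp [tauList]
  | succ i ih =>
    rw [Function.iterate_succ_apply', show m + (i + 1) + 1 = (m + 1) + i + 1 by omega, ih,
      stackSort_step]

/-- The permutation `2 3 ⋯ (k+1) 1 (k+2) ⋯`, with entry `1` at index `k`. -/
def vertex (n k : ℕ) : Fin n → ℝ := fun j =>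
  ((j : ℕ) : ℝ) + 1 + (if (j : ℕ) < k then 1 else 0) - (if (j : ℕ) = k then ((j : ℕ) : ℝ) else 0)

theorem toPoint_stackSort_iterate (n i : ℕ) (hi : i < n) :
    toPoint n (stackSort^[i] (tauList n)) = vertex n (n - 1 - i) := by
  obtain ⟨m, rfl⟩ : ∃ m, n = m + i + 1 := ⟨n - i - 1, by omega⟩
  rw [stackSort_iterate_tauList, show m + i + 1 - 1 - i = m by omega]
  funext j
  have hj := j.2
  rw [toPoint, vertex]
  rcases lt_trichotomy (j : ℕ) m with h | h | h
  · rw [List.getD_append _ _ _ _ (by simpa using h), List.getD_eq_getElem _ _ (by simpa using h)]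
    simp [h, h.ne]
    ring
  · rw [List.getD_append_right _ _ _ _ (by simp [h])]
    simp [h]
  · obtain ⟨r, hr⟩ : ∃ r, (j : ℕ) = m + r + 1 := ⟨j - m - 1, by omega⟩
    rw [List.getD_append_right _ _ _ _ (by simp; omega), List.length_range', hr,
      show m + r + 1 - m = r + 1 by omega, List.getD_cons_succ,
      List.getD_eq_getElem _ _ (by simp; omega), if_neg (by omega), if_neg (by omega)]
    simp
    ring

theorem ssIterates_eq (n : ℕ) : ssIterates n = Set.range fun k : Fin n => vertex n k := by
  ext x
  simp only [ssIterates, Set.mem_range]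
  constructor
  · rintro ⟨i, rfl⟩
    exact ⟨⟨n - 1 - i, by omega⟩, (toPoint_stackSort_iterate n i i.2).symm⟩
  · rintro ⟨k, rfl⟩
    refine ⟨⟨n - 1 - k, by omega⟩, ?_⟩
    dsimp only
    rw [toPoint_stackSort_iterate n _ (by omega), show n - 1 - (n - 1 - (k : ℕ)) = k by omega]

/-- The partial sums of `x` minus `c` times those of the identity permutation. -/
noncomputable def excess {n : ℕ} (c : ℝ) (x : Fin n → ℝ) (j : ℕ) : ℝ :=
  ∑ i ∈ Finset.range j, if h : i < n then x ⟨i, h⟩ - c * ((i : ℝ) + 1) else 0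

/-- A positive multiple of the `j`-th barycentric coordinate of `x` in the dilate of the simplex
by `c`. -/
noncomputable def facet {n : ℕ} (c : ℝ) (x : Fin n → ℝ) (j : ℕ) : ℝ :=
  if j = 0 then c - excess c x 1 else ((j : ℝ) + 1) * excess c x j - j * excess c x (j + 1)

theorem excess_zero {n : ℕ} (c : ℝ) (x : Fin n → ℝ) : excess c x 0 = 0 := by simp [excess]

theorem excess_succ {n : ℕ} (c : ℝ) (x : Fin n → ℝ) (j : Fin n) :
    excess c x (j + 1) = excess c x j + (x j - c * (((j : ℕ) : ℝ) + 1)) := by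
  rw [excess, Finset.sum_range_succ, dif_pos j.2, excess]

theorem continuous_excess {n : ℕ} (c : ℝ) (j : ℕ) :
    Continuous fun x : Fin n → ℝ => excess c x j := by
  unfold excess
  refine continuous_finsetSum _ fun i _ => ?_
  split_ifs <;> fun_prop

theorem continuous_facet {n : ℕ} (c : ℝ) (j : ℕ) :
    Continuous fun x : Fin n → ℝ => facet c x j := by
  have h := continuous_excess (n := n) c
  unfold facet
  split_ifs
  · exact continuous_const.sub (h 1)
  · exact (continuous_const.mul (h j)).sub (continuous_const.mul (h (j + 1)))

theorem excess_smul_sub_add {n : ℕ} (c s : ℝ) (x y z : Fin n → ℝ) (j : ℕ) :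
    excess c (s • (x - y) + z) j = s * (excess c x j - excess c y j) + excess c z j := by
  simp only [excess, ← Finset.sum_sub_distrib, Finset.mul_sum, ← Finset.sum_add_distrib]
  refine Finset.sum_congr rfl fun i _ => ?_
  split_ifs
  · simp
    ring
  · simp

theorem excess_combo {n : ℕ} (c : ℝ) (x y : Fin n → ℝ) {a b : ℝ} (hab : a + b = 1) (j : ℕ) :
    excess c (a • x + b • y) j = a * excess c x j + b * excess c y j := by
  obtain rfl : b = 1 - a := by linarith
  rw [show a • x + (1 - a) • y = a • (x - y) + y by module, excess_smul_sub_add]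
  ring

theorem facet_combo {n : ℕ} (c : ℝ) (x y : Fin n → ℝ) {a b : ℝ} (hab : a + b = 1) (j : ℕ) :
    facet c (a • x + b • y) j = a * facet c x j + b * facet c y j := by
  simp only [facet, excess_combo c x y hab]
  split_ifs
  · linear_combination (-c) * hab
  · ring

theorem excess_vertex {n : ℕ} (c : ℝ) (k : ℕ) {j : ℕ} (hj : j ≤ n) :
    excess c (c • vertex n k) j = if j ≤ k then c * j else 0 := by
  induction j with
  | zero => simp [excess_zero]
  | succ j ih =>
    rw [excess_succ c _ ⟨j, hj⟩, ih (by omega)]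
    simp only [Pi.smul_apply, vertex, smul_eq_mul]
    rcases lt_trichotomy j k with h | h | h
    · simp [h, h.le, h.ne, Nat.succ_le_of_lt h]
      ring
    · simp [h]
      ring
    · simp [h.not_ge, h.ne', h.not_gt, show ¬ j + 1 ≤ k by omega]

theorem facet_vertex {n : ℕ} (c : ℝ) (k : ℕ) {j : ℕ} (hj : j < n) :
    facet c (c • vertex n k) j =
      if j = k then (if j = 0 then c else c * j * ((j : ℝ) + 1)) else 0 := by
  rw [facet, excess_vertex c k (by omega : j + 1 ≤ n), excess_vertex c k hj.le,
    excess_vertex c k (by omega : 1 ≤ n)]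
  rcases Nat.eq_zero_or_pos j with rfl | h0
  · rcases Nat.eq_zero_or_pos k with rfl | hk
    · simp
    · simp [hk.ne, Nat.succ_le_of_lt hk]
  · rw [if_neg h0.ne', if_neg h0.ne']
    rcases lt_trichotomy j k with h | h | h
    · rw [if_pos h.le, if_pos (by omega), if_neg h.ne]
      push_cast
      ring
    · rw [if_pos h.le, if_neg (by omega), if_pos h]
      ring
    · rw [if_neg h.not_ge, if_neg (by omega), if_neg h.ne']
      ring

/-- The dilate of the simplex by `c`, described by its facet inequalities. -/
def facetSet (n : ℕ) (c : ℝ) : Set (Fin n → ℝ) :=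
  {x | excess c x n = 0 ∧ ∀ j < n, 0 ≤ facet c x j}

theorem convex_facetSet (n : ℕ) (c : ℝ) : Convex ℝ (facetSet n c) := by
  rintro x ⟨hx, hx'⟩ y ⟨hy, hy'⟩ a b ha hb hab
  refine ⟨by rw [excess_combo c x y hab, hx, hy]; ring, fun j hj => ?_⟩
  rw [facet_combo c x y hab]
  have := hx' j hj
  have := hy' j hj
  positivity

theorem smul_vertex_mem_facetSet {n : ℕ} {c : ℝ} (hc : 0 ≤ c) (k : Fin n) :
    c • vertex n k ∈ facetSet n c := by
  refine ⟨by rw [excess_vertex c k le_rfl, if_neg (by omega)], fun j hj => ?_⟩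
  rw [facet_vertex c k hj]
  split_ifs <;> positivity

theorem exists_weights {n : ℕ} (hn : 1 ≤ n) {c : ℝ} {x : Fin n → ℝ} (hx : x ∈ facetSet n c) :
    ∃ w : Fin n → ℝ, (∀ k, 0 ≤ w k) ∧ ∑ k, w k = c ∧ x = ∑ k, w k • vertex n k := by
  obtain ⟨h0, hf⟩ := hx
  set S : ℕ → ℝ := fun j => if j = 0 then c else excess c x j / j with hS
  have hSn : S n = 0 := by simp [hS, h0, show n ≠ 0 by omega]
  have hmul : ∀ j : ℕ, (j : ℝ) * S j = excess c x j := by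
    intro j
    rcases Nat.eq_zero_or_pos j with rfl | h
    · simp [excess_zero]
    · simp only [hS, if_neg h.ne']
      field_simp
  refine ⟨fun k => S k - S (k + 1), fun k => ?_, ?_, ?_⟩
  · have h := hf k k.2
    rw [sub_nonneg]
    rcases Nat.eq_zero_or_pos (k : ℕ) with hk | hk
    · simpa [hS, hk, facet] using h
    · simp only [facet, if_neg hk.ne', sub_nonneg] at h
      simp only [hS, if_neg hk.ne', if_neg (Nat.succ_ne_zero _)]
      rw [div_le_div_iff₀ (by positivity) (by positivity)]
      push_cast
      linarith
  · rw [Fin.sum_univ_eq_sum_range (fun k => S k - S (k + 1)), Finset.sum_range_sub', hSn]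
    simp [hS]
  · funext j
    have hstep := excess_succ c x j
    rw [← hmul, ← hmul] at hstep
    push_cast at hstep
    have htail : ∑ k ∈ Finset.range n, (if (j : ℕ) < k then S k - S (k + 1) else 0) =
        S (j + 1) := by
      have key : ∀ m, (j : ℕ) + 1 ≤ m →
          ∑ k ∈ Finset.range m, (if (j : ℕ) < k then S k - S (k + 1) else 0) =
            S (j + 1) - S m := by
        intro m hm
        induction m, hm using Nat.le_induction with
        | base =>
          rw [sub_self]
          exact Finset.sum_eq_zero fun k hk => if_neg (by simp at hk; omega)
        | succ m hm ih =>
          rw [Finset.sum_range_succ, ih, if_pos (by omega)]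
          ring
      rw [key n (by omega), hSn, sub_zero]
    have hall : ∑ k ∈ Finset.range n, (S k - S (k + 1)) = c := by
      rw [Finset.sum_range_sub', hSn]
      simp [hS]
    have hself : ∑ k ∈ Finset.range n, (if (j : ℕ) = k then S k - S (k + 1) else 0) =
        S j - S (j + 1) := by
      rw [Finset.sum_ite_eq, if_pos (by simp)]
    have hsum : (∑ k : Fin n, (S k - S (k + 1)) • vertex n k) j =
        (((j : ℕ) : ℝ) + 1) * c + S (j + 1) - (j : ℕ) * (S j - S (j + 1)) := by
      rw [← hself, ← hall, ← htail, Finset.sum_apply,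
        Fin.sum_univ_eq_sum_range
          (fun k => ((S k - S (k + 1)) • vertex n k) j)]
      rw [Finset.mul_sum, Finset.mul_sum, ← Finset.sum_add_distrib,
        ← Finset.sum_sub_distrib]
      refine Finset.sum_congr rfl fun k _ => ?_
      simp only [Pi.smul_apply, vertex, smul_eq_mul]
      split_ifs <;> ring
    rw [hsum]
    linarith

theorem smul_ssSimplex_eq {n : ℕ} (hn : 1 ≤ n) {c : ℝ} (hc : 0 ≤ c) :
    c • ssSimplex n = facetSet n c := by
  apply Set.Subset.antisymm
  · rw [ssSimplex, ssIterates_eq, ← convexHull_smul]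
    refine convexHull_min ?_ (convex_facetSet n c)
    rintro _ ⟨_, ⟨k, rfl⟩, rfl⟩
    exact smul_vertex_mem_facetSet hc k
  · intro x hx
    obtain ⟨w, hw, hsum, rfl⟩ := exists_weights hn hx
    have hv : ∀ k : Fin n, vertex n k ∈ ssSimplex n := fun k => by
      rw [ssSimplex, ssIterates_eq]
      exact subset_convexHull ℝ _ ⟨k, rfl⟩
    rcases hc.eq_or_lt with rfl | hc
    · have hw0 : ∀ k, w k = 0 := fun k =>
        (Finset.sum_eq_zero_iff_of_nonneg fun k _ => hw k).1 hsum k (Finset.mem_univ k)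
      rw [Set.zero_smul_set ⟨_, hv ⟨0, hn⟩⟩]
      simp [hw0]
    · refine ⟨∑ k, (w k / c) • vertex n k, (convex_convexHull ℝ _).sum_mem (fun k _ => ?_) ?_
        fun k _ => hv k, ?_⟩
      · have := hw k
        positivity
      · rw [← Finset.sum_div, hsum, div_self hc.ne']
      · simp only [Finset.smul_sum, smul_smul, mul_div_cancel₀ _ hc.ne']

theorem intrinsicInterior_facetSet {n : ℕ} {c : ℝ} (hc : 0 < c) :
    intrinsicInterior ℝ (facetSet n c) =
      {x | excess c x n = 0 ∧ ∀ j < n, 0 < facet c x j} := by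
  ext x
  rw [mem_intrinsicInterior]
  constructor
  · rintro ⟨⟨x, hx⟩, hint, rfl⟩
    have hxP : x ∈ facetSet n c :=
      (interior_subset hint : (⟨x, hx⟩ : affineSpan ℝ _) ∈ Subtype.val ⁻¹' facetSet n c)
    refine ⟨hxP.1, fun j hj => ?_⟩
    have hp : c • vertex n j ∈ affineSpan ℝ (facetSet n c) :=
      subset_affineSpan ℝ _ (smul_vertex_mem_facetSet hc.le ⟨j, hj⟩)
    let γ : ℝ → affineSpan ℝ (facetSet n c) := fun s =>
      ⟨AffineMap.lineMap (c • vertex n j) x s, AffineMap.lineMap_mem s hp hx⟩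
    have hγ : Continuous γ := AffineMap.lineMap_continuous.subtype_mk _
    have hγ1 : γ 1 = ⟨x, hx⟩ := by simp [γ]
    have hnhds : γ ⁻¹' interior ((↑) ⁻¹' facetSet n c) ∈ nhds (1 : ℝ) :=
      (isOpen_interior.preimage hγ).mem_nhds (by rw [Set.mem_preimage, hγ1]; exact hint)
    obtain ⟨ε, hε, hball⟩ := Metric.mem_nhds_iff.1 hnhds
    have hmem : γ (1 + ε / 2) ∈ interior ((↑) ⁻¹' facetSet n c) := hball (by
      rw [Metric.mem_ball, Real.dist_eq, add_sub_cancel_left, abs_of_pos (by positivity)]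
      linarith)
    have hmem' : AffineMap.lineMap (c • vertex n j) x (1 + ε / 2) ∈ facetSet n c :=
      (interior_subset hmem : γ (1 + ε / 2) ∈ Subtype.val ⁻¹' facetSet n c)
    have hge := hmem'.2 j hj
    rw [AffineMap.lineMap_apply_module, facet_combo c _ _ (by ring), facet_vertex c j hj,
      if_pos rfl] at hge
    have hpos : 0 < if j = 0 then c else c * j * ((j : ℝ) + 1) := by
      split_ifs with h
      · exact hc
      · have : 0 < j := Nat.pos_of_ne_zero h
        positivity
    by_contra! hle
    have h1 : (1 + ε / 2) * facet c x j ≤ 0 := mul_nonpos_of_nonneg_of_nonpos (by positivity) hle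
    have h2 := mul_pos (half_pos hε) hpos
    linarith
  · rintro ⟨h0, hpos⟩
    have hxP : x ∈ facetSet n c := ⟨h0, fun j hj => (hpos j hj).le⟩
    refine ⟨⟨x, subset_affineSpan ℝ _ hxP⟩, ?_, rfl⟩
    rw [mem_interior]
    have hspan : ∀ y ∈ affineSpan ℝ (facetSet n c), excess c y n = 0 := by
      let A : AffineSubspace ℝ (Fin n → ℝ) :=
        { carrier := {y | excess c y n = 0}
          smul_vsub_vadd_mem' := fun s u v w hu hv hw => by
            simp only [Set.mem_ofPred_eq] at hu hv hw ⊢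
            rw [vsub_eq_sub, vadd_eq_add, excess_smul_sub_add, hu, hv, hw]
            ring }
      intro y hy
      exact (affineSpan_le.2 (fun z hz => hz.1) : affineSpan ℝ (facetSet n c) ≤ A) hy
    refine ⟨{y | ∀ j : Fin n, 0 < facet c (y : Fin n → ℝ) j},
      fun y hy => ⟨hspan y y.2, fun j hj => (hy ⟨j, hj⟩).le⟩, ?_, fun j => hpos j j.2⟩
    simp only [Set.ofPred_forall]
    exact isOpen_iInter_of_finite fun j =>
      isOpen_lt continuous_const ((continuous_facet c j).comp continuous_subtype_val)

/-- The integer sequences `y` supported on `{1, …, d}` with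
`t ≥ y 1 ≥ y 2 / 2 ≥ ⋯ ≥ y d / d ≥ z / d`. -/
def lectureHall (d : ℕ) (t z : ℤ) : Set (ℕ → ℤ) :=
  {y | y 0 = 0 ∧ y 1 ≤ t ∧ (∀ j < d, (j : ℤ) * y (j + 1) ≤ ((j : ℤ) + 1) * y j) ∧ z ≤ y d ∧
    ∀ j, d < j → y j = 0}

theorem le_mul_of_mem_lectureHall {d : ℕ} {t z : ℤ} {y : ℕ → ℤ} (hy : y ∈ lectureHall d t z)
    {j : ℕ} (hj : j ≤ d) : y j ≤ j * t := by
  obtain ⟨h0, h1, hle, -, -⟩ := hy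
  induction j with
  | zero => simp [h0]
  | succ j ih =>
    rcases Nat.eq_zero_or_pos j with rfl | hpos
    · simpa using h1
    · have h := hle j (by omega)
      have h' := ih (by omega)
      have hpos' : (0 : ℤ) < j := by exact_mod_cast hpos
      refine le_of_mul_le_mul_left ?_ hpos'
      push_cast
      nlinarith

theorem nonneg_of_mem_lectureHall {d : ℕ} {t : ℤ} {y : ℕ → ℤ} (hy : y ∈ lectureHall d t 0)
    {j : ℕ} (hj : j ≤ d) : 0 ≤ y j := by
  obtain ⟨-, -, hle, hd, -⟩ := hy
  induction hj using Nat.decreasingInduction with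
  | self => exact hd
  | of_succ j hj ih =>
    have h := hle j hj
    have h' : 0 ≤ (j : ℤ) * y (j + 1) := by positivity
    exact nonneg_of_mul_nonneg_right (h'.trans h) (by positivity)

theorem lectureHall_zero {t : ℤ} (ht : 0 ≤ t) : lectureHall 0 t 0 = {0} := by
  ext y
  simp only [lectureHall, Set.mem_ofPred_eq, Set.mem_singleton_iff]
  constructor
  · rintro ⟨h0, -, -, -, h⟩
    funext j
    rcases Nat.eq_zero_or_pos j with rfl | hj
    · exact h0
    · exact h j hj
  · rintro rfl
    simpa using ht

theorem lectureHall_succ (d : ℕ) {t q : ℤ} (ht : 0 ≤ t) (hq : q ≤ t) {r : ℕ} (hr : r ≤ d) :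
    lectureHall (d + 1) t ((d + 1) * q + r) =
      lectureHall (d + 1) t ((d + 1) * q + r + 1) ∪
        (fun y => Function.update y (d + 1) ((d + 1) * q + r)) '' lectureHall d t (d * q + r) := by
  have hr' : (r : ℤ) ≤ d := by exact_mod_cast hr
  have hr0 : (0 : ℤ) ≤ r := by positivity
  have hd0 : (0 : ℤ) ≤ d := by positivity
  ext y
  constructor
  · rintro ⟨h0, h1, hle, hz, hs⟩
    rcases hz.lt_or_eq with hz | hz
    · exact Or.inl ⟨h0, h1, hle, hz, hs⟩
    · refine Or.inr ⟨Function.update y (d + 1) 0, ⟨?_, ?_, fun j hj => ?_, ?_, fun j hj => ?_⟩, ?_⟩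
      · simpa using h0
      · rcases Nat.eq_zero_or_pos d with rfl | hd
        · simpa using ht
        · rwa [Function.update_of_ne (by omega)]
      · rw [Function.update_of_ne (by omega), Function.update_of_ne (by omega)]
        exact hle j (by omega)
      · rw [Function.update_of_ne (by omega)]
        have h := hle d (by omega)
        rw [← hz] at h
        by_contra! hlt
        nlinarith
      · rcases eq_or_ne j (d + 1) with rfl | hne
        · simp
        · rw [Function.update_of_ne hne]
          exact hs j (by omega)
      · simp [hz]
  · rintro (⟨h0, h1, hle, hz, hs⟩ | ⟨y, ⟨h0, h1, hle, hz, hs⟩, rfl⟩)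
    · exact ⟨h0, h1, hle, by omega, hs⟩
    · dsimp only
      refine ⟨?_, ?_, fun j hj => ?_, ?_, fun j hj => ?_⟩
      · simpa using h0
      · rcases Nat.eq_zero_or_pos d with rfl | hd
        · obtain rfl : r = 0 := by omega
          simpa using hq
        · rwa [Function.update_of_ne (by omega)]
      · rcases (Nat.lt_succ_iff.1 hj).lt_or_eq with hj | rfl
        · rw [Function.update_of_ne (by omega), Function.update_of_ne (by omega)]
          exact hle j hj
        · rw [Function.update_self, Function.update_of_ne (by omega)]
          nlinarith
      · simp
      · rw [Function.update_of_ne (by omega)]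
        exact hs j (by omega)

theorem encard_lectureHall_succ_of_top {d m : ℕ} {t : ℤ} (ht : 0 ≤ t)
    (hd : ∀ r s, r + s = d →
      (lectureHall d t (d * (t - m) + r)).encard = (m ^ r * (m + 1) ^ s : ℕ))
    (htop : (lectureHall (d + 1) t ((d + 1 : ℕ) * (t - m) + (d + 1 : ℕ))).encard =
      (m ^ (d + 1) : ℕ))
    {r s : ℕ} (hrs : r + s = d + 1) :
    (lectureHall (d + 1) t ((d + 1 : ℕ) * (t - m) + r)).encard = (m ^ r * (m + 1) ^ s : ℕ) := by
  induction s generalizing r with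
  | zero =>
    obtain rfl : r = d + 1 := by omega
    simpa using htop
  | succ s ih =>
    have h := ih (r := r + 1) (by omega)
    push_cast at h ⊢
    rw [← add_assoc] at h
    rw [lectureHall_succ d ht (by omega) (by omega), Set.encard_union_eq, h, Set.InjOn.encard_image,
      hd r s (by omega)]
    · push_cast
      ring
    · intro y hy y' hy' heq
      funext j
      rcases eq_or_ne j (d + 1) with rfl | hne
      · rw [hy.2.2.2.2 _ (by omega), hy'.2.2.2.2 _ (by omega)]
      · have := congrFun heq j
        simpa [Function.update_of_ne hne] using this
    · rw [Set.disjoint_left]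
      rintro _ ⟨-, -, -, hz, -⟩ ⟨y, -, rfl⟩
      simp at hz

theorem encard_lectureHall {t : ℤ} (ht : 0 ≤ t) (d m r s : ℕ) (hrs : r + s = d) :
    (lectureHall d t (d * (t - m) + r)).encard = (m ^ r * (m + 1) ^ s : ℕ) := by
  induction d generalizing m r s with
  | zero =>
    obtain ⟨rfl, rfl⟩ : r = 0 ∧ s = 0 := by omega
    simp [lectureHall_zero ht]
  | succ d ihd =>
    induction m generalizing r s with
    | zero =>
      refine encard_lectureHall_succ_of_top ht (ihd 0) ?_ hrs
      rw [Set.encard_eq_zero.2]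
      · simp
      · refine Set.eq_empty_of_forall_notMem fun y hy => ?_
        have h := le_mul_of_mem_lectureHall hy le_rfl
        have h' := hy.2.2.2.1
        push_cast at h h'
        nlinarith
    | succ m ihm =>
      refine encard_lectureHall_succ_of_top ht (ihd (m + 1)) ?_ hrs
      have h := ihm 0 (d + 1) (by omega)
      rw [pow_zero, one_mul] at h
      rw [← h]
      congr 2
      push_cast
      ring

/-- The point of `ℝⁿ` whose excess over the `c`-th multiple of the identity permutation has
partial sums `y`. -/
def ofExcess (n : ℕ) (c : ℝ) (y : ℕ → ℤ) : Fin n → ℝ := fun i =>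
  (y (i + 1) : ℝ) - y i + c * (((i : ℕ) : ℝ) + 1)

theorem excess_ofExcess {n : ℕ} (c : ℝ) {y : ℕ → ℤ} (h0 : y 0 = 0) {j : ℕ} (hj : j ≤ n) :
    excess c (ofExcess n c y) j = y j := by
  induction j with
  | zero => simp [excess_zero, h0]
  | succ j ih =>
    rw [excess_succ c _ ⟨j, hj⟩, ih (by omega)]
    simp [ofExcess]

theorem lattCount_eq_ncard {n : ℕ} (c : ℤ) {S : Set (Fin n → ℝ)}
    (hS : ∀ x ∈ S, excess (c : ℝ) x n = 0) :
    lattCount S =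
      {y : ℕ → ℤ | y 0 = 0 ∧ (∀ j, n ≤ j → y j = 0) ∧ ofExcess n c y ∈ S}.ncard := by
  rw [← Set.InjOn.ncard_image (f := ofExcess n c), lattCount]
  · congr 1
    ext x
    constructor
    · rintro ⟨hx, hz⟩
      choose z hz using hz
      let y : ℕ → ℤ := fun j => if j < n then
        ∑ i ∈ Finset.range j, if h : i < n then z ⟨i, h⟩ - c * ((i : ℤ) + 1) else 0 else 0
      have hy : ∀ j ≤ n, (y j : ℝ) = excess (c : ℝ) x j := by
        intro j hj
        rcases hj.lt_or_eq with hj | rfl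
        · simp only [y, if_pos hj, excess, Int.cast_sum]
          refine Finset.sum_congr rfl fun i _ => ?_
          split_ifs
          · simp [hz]
          · simp
        · simp [y, hS x hx]
      have hxy : ofExcess n c y = x := by
        funext i
        rw [ofExcess, hy _ i.2, hy _ i.2.le, excess_succ]
        ring
      refine ⟨y, ⟨?_, fun j hj => if_neg (by omega), by rwa [hxy]⟩, hxy⟩
      simp [y]
    · rintro ⟨y, ⟨-, -, hy⟩, rfl⟩
      refine ⟨hy, fun i => ⟨y (i + 1) - y i + c * ((i : ℕ) + 1), ?_⟩⟩
      simp [ofExcess]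
  · rintro y ⟨hy0, hyn, -⟩ y' ⟨hy0', hyn', -⟩ h
    funext j
    rcases le_total j n with hj | hj
    · have hj' := excess_ofExcess (c : ℝ) hy0 hj
      rw [h, excess_ofExcess (c : ℝ) hy0' hj] at hj'
      exact_mod_cast hj'.symm
    · rw [hyn j hj, hyn' j hj]

theorem facet_ofExcess {n : ℕ} (c : ℤ) {y : ℕ → ℤ} (h0 : y 0 = 0) {j : ℕ} (hj : j < n) :
    facet (c : ℝ) (ofExcess n c y) j =
      ((if j = 0 then c - y 1 else ((j : ℤ) + 1) * y j - j * y (j + 1) : ℤ) : ℝ) := by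
  rw [facet, excess_ofExcess _ h0 hj.le, excess_ofExcess _ h0 hj,
    excess_ofExcess _ h0 (by omega : 1 ≤ n)]
  split_ifs <;> push_cast <;> rfl

theorem lattCount_facetSet (d : ℕ) (t : ℤ) :
    lattCount (facetSet (d + 1) (t : ℝ)) = (lectureHall d t 0).ncard := by
  rw [lattCount_eq_ncard t fun x hx => hx.1]
  congr 1
  ext y
  constructor
  · rintro ⟨h0, hs, -, hf⟩
    have hf' : ∀ j < d + 1, 0 ≤ if j = 0 then t - y 1 else ((j : ℤ) + 1) * y j - j * y (j + 1) :=
      fun j hj => by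
        have h := hf j hj
        rw [facet_ofExcess t h0 hj] at h
        exact_mod_cast h
    refine ⟨h0, by simpa using hf' 0 (by omega), fun j hj => ?_, ?_, hs⟩
    · rcases Nat.eq_zero_or_pos j with rfl | hpos
      · simp [h0]
      · simpa [hpos.ne'] using hf' j (by omega)
    · rcases Nat.eq_zero_or_pos d with rfl | hpos
      · exact h0.ge
      · have h := hf' d (by omega)
        rw [if_neg hpos.ne', hs (d + 1) le_rfl] at h
        exact nonneg_of_mul_nonneg_right (by simpa using h) (by positivity : (0 : ℤ) < (d : ℤ) + 1)
  · rintro ⟨h0, h1, hle, hd, hs⟩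
    refine ⟨h0, hs, ?_, fun j hj => ?_⟩
    · rw [excess_ofExcess _ h0 le_rfl, hs _ (by omega), Int.cast_zero]
    · rw [facet_ofExcess t h0 hj]
      norm_cast
      split_ifs with hj0
      · omega
      · rw [sub_nonneg]
        rcases (Nat.lt_succ_iff.1 hj).lt_or_eq with hj | rfl
        · exact hle j hj
        · rw [hs (j + 1) (by omega), mul_zero]
          positivity

theorem lattCount_intrinsicInterior_facetSet {d : ℕ} (hd : 1 ≤ d) {t : ℤ} (ht : -1 ≤ t) :
    lattCount (intrinsicInterior ℝ (facetSet (d + 1) ((t : ℝ) + 2))) =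
      (lectureHall d t 0).ncard := by
  have hpos : (0 : ℝ) < ((t + 2 : ℤ) : ℝ) := by
    exact_mod_cast (by omega : 0 < t + 2)
  rw [show (t : ℝ) + 2 = ((t + 2 : ℤ) : ℝ) by push_cast; rfl, intrinsicInterior_facetSet hpos,
    lattCount_eq_ncard (t + 2) fun x hx => hx.1]
  let e : ℕ → ℤ := fun j => if 1 ≤ j ∧ j ≤ d then 1 else 0
  have he : ∀ j, 1 ≤ j → j ≤ d → e j = 1 := fun j h h' => if_pos ⟨h, h'⟩
  have he0 : e 0 = 0 := if_neg (by omega)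
  have hes : ∀ j, d < j → e j = 0 := fun j h => if_neg (by omega)
  rw [← Set.ncard_image_of_injective (lectureHall d t 0) (add_left_injective e)]
  congr 1
  ext y
  constructor
  · rintro ⟨h0, hs, -, hf⟩
    have hf' : ∀ j < d + 1,
        0 < if j = 0 then t + 2 - y 1 else ((j : ℤ) + 1) * y j - j * y (j + 1) :=
      fun j hj => by
        have h := hf j hj
        rw [facet_ofExcess _ h0 hj] at h
        exact_mod_cast h
    refine ⟨y - e, ⟨?_, ?_, fun j hj => ?_, ?_, fun j hj => ?_⟩, sub_add_cancel y e⟩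
    · simp [h0, he0]
    · have h := hf' 0 (by omega)
      rw [if_pos rfl] at h
      rw [Pi.sub_apply, he 1 le_rfl hd]
      omega
    · rcases Nat.eq_zero_or_pos j with rfl | hpos
      · simp [h0, he0]
      · have h := hf' j (by omega)
        rw [if_neg hpos.ne'] at h
        rw [Pi.sub_apply, Pi.sub_apply, he j hpos hj.le, he (j + 1) (by omega) hj]
        linarith
    · have h := hf' d (by omega)
      rw [if_neg (by omega), hs (d + 1) le_rfl, mul_zero, sub_zero] at h
      have h' := pos_of_mul_pos_right h (by positivity)
      rw [Pi.sub_apply, he d hd le_rfl]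
      omega
    · rw [Pi.sub_apply, hs j hj, hes j hj, sub_zero]
  · rintro ⟨y, ⟨h0, h1, hle, hz, hs⟩, rfl⟩
    have h0' : (y + e) 0 = 0 := by rw [Pi.add_apply, h0, he0, add_zero]
    have hs' : ∀ j, d + 1 ≤ j → (y + e) j = 0 := fun j hj => by
      rw [Pi.add_apply, hs j hj, hes j hj, add_zero]
    refine ⟨h0', hs', ?_, fun j hj => ?_⟩
    · rw [excess_ofExcess _ h0' le_rfl, hs' _ le_rfl, Int.cast_zero]
    · dsimp only
      rw [facet_ofExcess _ h0' hj]
      norm_cast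
      split_ifs with hj0
      · rw [Pi.add_apply, he 1 le_rfl hd]
        omega
      · rw [sub_pos, Pi.add_apply y e j, he j (by omega) (by omega)]
        rcases (Nat.lt_succ_iff.1 hj).lt_or_eq with hj | rfl
        · have h := hle j hj
          rw [Pi.add_apply, he (j + 1) (by omega) hj]
          push_cast
          linarith
        · rw [hs' (j + 1) (by omega), mul_zero]
          positivity

theorem ncard_lectureHall (d t : ℕ) : (lectureHall d t 0).ncard = (t + 1) ^ d := by
  have h := encard_lectureHall (Int.natCast_nonneg t) d t 0 d (Nat.zero_add d)
  simp only [sub_self, mul_zero, Nat.cast_zero, add_zero, pow_zero, one_mul] at h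
  rw [Set.ncard, h, ENat.toNat_natCast]

theorem lectureHall_neg_one {d : ℕ} (hd : 1 ≤ d) : lectureHall d (-1) 0 = ∅ :=
  Set.eq_empty_of_forall_notMem fun y hy => by
    have h := nonneg_of_mem_lectureHall hy hd
    have h' := hy.2.1
    omega

/-- For `n ≥ 2`, the simplex `△ₙ` is Gorenstein of
index `2`: the relative interior of `△ₙ` contains no integer point, the
relative interior of `2△ₙ` contains exactly one integer point, and for
every nonnegative integer `t` the relative interior of `(t+2)△ₙ` contains
exactly as many integer points as `t△ₙ`, namely `(t+1)^{n-1}`. -/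
theorem ssSimplex_gorenstein_two (n : ℕ) (hn : 2 ≤ n) :
    lattCount (intrinsicInterior ℝ ((1 : ℝ) • ssSimplex n)) = 0 ∧
    lattCount (intrinsicInterior ℝ ((2 : ℝ) • ssSimplex n)) = 1 ∧
    ∀ t : ℕ,
      lattCount (intrinsicInterior ℝ (((t : ℝ) + 2) • ssSimplex n)) =
        lattCount ((t : ℝ) • ssSimplex n) ∧
      lattCount ((t : ℝ) • ssSimplex n) = (t + 1) ^ (n - 1) := by
  obtain ⟨d, rfl⟩ : ∃ d, n = d + 1 := ⟨n - 1, by omega⟩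
  have hd : 1 ≤ d := by omega
  have hint : ∀ t : ℕ, lattCount (intrinsicInterior ℝ (((t : ℝ) + 2) • ssSimplex (d + 1))) =
      (t + 1) ^ d := fun t => by
    have h := lattCount_intrinsicInterior_facetSet hd (by omega : -1 ≤ (t : ℤ))
    rw [Int.cast_natCast, ncard_lectureHall] at h
    rw [smul_ssSimplex_eq (by omega) (by positivity), h]
  refine ⟨?_, ?_, fun t => ?_⟩
  · have h := lattCount_intrinsicInterior_facetSet hd (le_refl (-1))
    rw [lectureHall_neg_one hd, Set.ncard_empty] at h
    rw [smul_ssSimplex_eq (by omega) zero_le_one, ← h]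
    norm_num
  · simpa using hint 0
  · have h : lattCount ((t : ℝ) • ssSimplex (d + 1)) = (t + 1) ^ d := by
      have h := lattCount_facetSet d t
      rw [Int.cast_natCast, ncard_lectureHall] at h
      rw [smul_ssSimplex_eq (by omega) (by positivity), h]
    exact ⟨by rw [hint, h], h⟩
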